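/- Let X be simple and atomic and m ≥ 1, and set β := β(X^(m)). Then every set in the Blackwell decomposition for X^(m) is almost closed with respect to X^(kβ) for all k ≥ 1. Moreover, β(X^(β)) = β. -/

import Mathlib

open MeasureTheory Filter Set ProbabilityTheory

/-- A discrete-time Markov chain on a state space `S`: a stochastic transition
matrix `P`, an initial distribution `init`, and the induced probability measure
`μ` on the path space `ℕ → S`, determined by its values on cylinder sets. -/
structure MarkovChain (S : Type) [MeasurableSpace S] where
  P : S → S → ℝ
  P_nonneg : ∀ i j, 0 ≤ P i j
  P_stochastic : ∀ i, HasSum (P i) 1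
  init : S → ℝ
  init_nonneg : ∀ i, 0 ≤ init i
  init_hasSum : HasSum init 1
  μ : Measure (ℕ → S)
  μ_prob : IsProbabilityMeasure μ
  μ_cylinder : ∀ (n : ℕ) (s : ℕ → S),
    μ {ω | ∀ k ≤ n, ω k = s k}
      = ENNReal.ofReal (init (s 0) * ∏ k ∈ Finset.range n, P (s k) (s (k + 1)))

namespace MarkovChain

variable {S : Type} [MeasurableSpace S]

open Classical in
/-- The `n`-step transition probabilities `P^n(i,j)`. -/
noncomputable def Pn (X : MarkovChain S) : ℕ → S → S → ℝ
  | 0, i, j => if i = j then 1 else 0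
  | n + 1, i, j => ∑' k : S, X.Pn n i k * X.P k j

/-- Irreducibility: every state can be reached from every state. -/
def Irreducible (X : MarkovChain S) : Prop := ∀ i j : S, ∃ n : ℕ, 0 < X.Pn n i j

/-- Aperiodicity: for each state, the gcd of the set `{n ≥ 1 | P^n(i,i) > 0}`
is `1` (expressed via common divisors). -/
def Aperiodic (X : MarkovChain S) : Prop :=
  ∀ i : S, ∀ d : ℕ, (∀ n : ℕ, 0 < n → 0 < X.Pn n i i → d ∣ n) → d = 1

/-- `U^(m)(C)`: the event that the `m`-step chain visits `C` infinitely often. -/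
def U (X : MarkovChain S) (m : ℕ) (C : Set S) : Set (ℕ → S) :=
  {ω | ∀ n : ℕ, ∃ k : ℕ, n ≤ k ∧ ω (k * m) ∈ C}

/-- `L^(m)(C)`: the event that the `m`-step chain is eventually in `C`. -/
def L (X : MarkovChain S) (m : ℕ) (C : Set S) : Set (ℕ → S) :=
  {ω | ∃ n : ℕ, ∀ k : ℕ, n ≤ k → ω (k * m) ∈ C}

/-- `C` is transient with respect to the `m`-step chain `X^(m)`. -/
def Transient (X : MarkovChain S) (m : ℕ) (C : Set S) : Prop := X.μ (X.U m C) = 0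

/-- `C` is regular with respect to `X^(m)`: `U^(m)(C)` and `L^(m)(C)` agree up
to a null event. -/
def Regular (X : MarkovChain S) (m : ℕ) (C : Set S) : Prop :=
  X.μ (symmDiff (X.U m C) (X.L m C)) = 0

/-- `C` is almost closed with respect to `X^(m)`: regular but not transient. -/
def AlmostClosed (X : MarkovChain S) (m : ℕ) (C : Set S) : Prop :=
  X.Regular m C ∧ ¬ X.Transient m C

/-- An almost closed set is atomic if it does not contain two disjoint almost
closed subsets. -/
def Atomic (X : MarkovChain S) (m : ℕ) (C : Set S) : Prop :=
  X.AlmostClosed m C ∧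
    ¬ ∃ A B : Set S, A ⊆ C ∧ B ⊆ C ∧ Disjoint A B ∧
      X.AlmostClosed m A ∧ X.AlmostClosed m B

/-- A Blackwell decomposition for the `m`-step chain `X^(m)`: a countable
collection of pairwise disjoint almost closed sets, all atomic except at most
one, where a nonatomic member contains no atomic subsets and consists of
transient states, and such that the probabilities `μ(L^(m)(C))` sum to one. -/
structure IsBlackwell (X : MarkovChain S) (m : ℕ) (𝒞 : Set (Set S)) : Prop where
  countable : 𝒞.Countable
  almostClosed : ∀ C ∈ 𝒞, X.AlmostClosed m C
  disjoint : 𝒞.PairwiseDisjoint id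
  atMostOneNonatomic : ∀ C₁ ∈ 𝒞, ∀ C₂ ∈ 𝒞, ¬ X.Atomic m C₁ → ¬ X.Atomic m C₂ → C₁ = C₂
  nonatomicNoAtomicSubset : ∀ C ∈ 𝒞, ¬ X.Atomic m C → ∀ A : Set S, A ⊆ C → ¬ X.Atomic m A
  nonatomicTransientStates : ∀ C ∈ 𝒞, ¬ X.Atomic m C → ∀ i ∈ C, X.Transient m {i}
  sum_L_eq_one : ∑' C : 𝒞, X.μ (X.L m (C : Set S)) = 1

/-- `β(X^(m))`: the number of sets in a Blackwell decomposition for `X^(m)`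
(well defined since the decomposition is unique up to equivalence). -/
noncomputable def beta (X : MarkovChain S) (m : ℕ) : ℕ∞ :=
  sInf (Set.encard '' {𝒞 : Set (Set S) | X.IsBlackwell m 𝒞})

/-- `X` is simple if `β(X) = 1`. -/
def Simple (X : MarkovChain S) : Prop := X.beta 1 = 1

/-- The asymptotic period `d(X) = sup {m ≥ 1 | β(X^(m)) = m}` (possibly `∞`). -/
noncomputable def period (X : MarkovChain S) : ℕ∞ :=
  sSup {d : ℕ∞ | ∃ m : ℕ, 1 ≤ m ∧ X.beta m = (m : ℕ∞) ∧ d = (m : ℕ∞)}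

/-- Recurrence: every state is visited infinitely often almost surely. -/
def Recurrent (X : MarkovChain S) : Prop := ∀ i : S, X.μ (X.U 1 {i}) = 1

end MarkovChain

/-- The shift operator `θ` on path space: `(θ ω)(n) = ω(n+1)`. -/
def pathShift {S : Type} : (ℕ → S) → ℕ → S := fun ω n => ω (n + 1)

/-- An event `E` is `m`-invariant if its indicator function `f` satisfies
`f(ω) = f(θ^m ω)` for all paths `ω`. -/
def MInvariant {S : Type} (m : ℕ) (E : Set (ℕ → S)) : Prop :=
  ∀ ω : ℕ → S, ω ∈ E ↔ pathShift^[m] ω ∈ E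

/-- A birth-death process: a Markov chain on `ℕ` with positive birth
probabilities `p_i = P(i,i+1)`, positive death probabilities `q_{i+1} = P(i+1,i)`,
all transition probabilities other than `p_i`, `q_i` and `r_i = P(i,i)` zero,
and at least one positive self-transition probability. -/
structure MarkovChain.IsBirthDeath (X : MarkovChain ℕ) : Prop where
  birth_pos : ∀ i : ℕ, 0 < X.P i (i + 1)
  death_pos : ∀ i : ℕ, 0 < X.P (i + 1) i
  tridiagonal : ∀ i j : ℕ, 1 < |(i : ℤ) - (j : ℤ)| → X.P i j = 0
  self_pos : ∃ i : ℕ, 0 < X.P i i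

section AtomicCounting

variable {Ω ι : Type*} [MeasurableSpace Ω] {μ : Measure Ω} {T : Ω → Ω} {m : ℕ}

/-- If `T` preserves null sets among measurable `T^m`-invariant sets, then so do all iterates. -/
lemma ae_iterate_notMem_of_invariant (hT : Measurable T)
    (hnull : ∀ G, MeasurableSet G → T^[m] ⁻¹' G = G → (∀ᵐ ω ∂μ, ω ∉ G) → ∀ᵐ ω ∂μ, T ω ∉ G)
    (r : ℕ) {G : Set Ω} (hG : MeasurableSet G) (hinv : T^[m] ⁻¹' G = G)
    (h0 : ∀ᵐ ω ∂μ, ω ∉ G) : ∀ᵐ ω ∂μ, T^[r] ω ∉ G := by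
  induction r generalizing G with
  | zero => exact h0
  | succ r ih =>
    have h := ih (hT hG) (by
      rw [← preimage_comp, Function.Commute.self_iterate T m |>.comp_eq, preimage_comp, hinv])
      (hnull G hG hinv h0)
    filter_upwards [h] with ω hω
    rwa [Function.iterate_succ_apply']

/-- If `T` acts ergodically and the `T^m`-invariant `σ`-algebra is generated, up to null sets,
by a countable family of disjoint atoms, then the number of atoms is finite, divides `m`, and the
corresponding iterate of `T` fixes each of the atoms. -/
lemma card_atoms_dvd [Countable ι] (hT : Measurable T) (hm : 1 ≤ m)
    (hnull : ∀ G, MeasurableSet G → T^[m] ⁻¹' G = G → (∀ᵐ ω ∂μ, ω ∉ G) → ∀ᵐ ω ∂μ, T ω ∉ G)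
    (herg : ∀ G, MeasurableSet G → T ⁻¹' G = G → (∀ᵐ ω ∂μ, ω ∉ G) ∨ ∀ᵐ ω ∂μ, ω ∈ G)
    (E : ι → Set Ω) (hE : ∀ i, MeasurableSet (E i)) (hEinv : ∀ i, T^[m] ⁻¹' E i = E i)
    (hpos : ∀ i, ¬ ∀ᵐ ω ∂μ, ω ∉ E i) (hdisj : ∀ i j, i ≠ j → Disjoint (E i) (E j))
    (hcover : ∀ᵐ ω ∂μ, ∃ i, ω ∈ E i)
    (hatom : ∀ i G, MeasurableSet G → T^[m] ⁻¹' G = G →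
      (∀ᵐ ω ∂μ, ω ∈ E i → ω ∉ G) ∨ ∀ᵐ ω ∂μ, ω ∈ E i → ω ∈ G) (i₀ : ι) :
    0 < Nat.card ι ∧ Nat.card ι ∣ m ∧
      ∀ k, ∀ᵐ ω ∂μ, (T^[k * Nat.card ι] ω ∈ E i₀ ↔ ω ∈ E i₀) := by
  have hTm : ∀ r, Measurable T^[r] := fun r => hT.iterate r
  have hpull := fun (r : ℕ) (G : Set Ω) (hG : MeasurableSet G) (hi : T^[m] ⁻¹' G = G) h0 =>
    ae_iterate_notMem_of_invariant hT hnull r hG hi h0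
  have hinv : ∀ i ω, T^[m] ω ∈ E i ↔ ω ∈ E i := fun i ω => by
    conv_rhs => rw [← hEinv i]
    rfl
  have hinv' : ∀ i r ω, T^[r] (T^[m] ω) ∈ E i ↔ T^[r] ω ∈ E i := fun i r ω => by
    rw [← Function.iterate_add_apply, add_comm, Function.iterate_add_apply, hinv]
  have hEr : ∀ i r, T^[m] ⁻¹' (T^[r] ⁻¹' E i) = T^[r] ⁻¹' E i := fun i r => by
    ext ω; exact hinv' i r ω
  have himp : ∀ (r a c : ℕ) (i j : ι), (∀ᵐ ω ∂μ, T^[a] ω ∈ E i → T^[c] ω ∈ E j) →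
      ∀ᵐ ω ∂μ, T^[a + r] ω ∈ E i → T^[c + r] ω ∈ E j := by
    intro r a c i j h
    have := hpull r ((T^[a] ⁻¹' E i) \ (T^[c] ⁻¹' E j)) ((hTm a (hE i)).diff (hTm c (hE j)))
      (by rw [preimage_sdiff, hEr, hEr]) (by filter_upwards [h] with ω hω using fun h' => h'.2 (hω h'.1))
    filter_upwards [this] with ω hω h1
    rw [Function.iterate_add_apply] at h1 ⊢
    by_contra h2
    exact hω ⟨h1, h2⟩
  have hdis : ∀ (r a c : ℕ) (i j : ι), (∀ᵐ ω ∂μ, T^[a] ω ∈ E i → T^[c] ω ∉ E j) →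
      ∀ᵐ ω ∂μ, T^[a + r] ω ∈ E i → T^[c + r] ω ∉ E j := by
    intro r a c i j h
    have := hpull r ((T^[a] ⁻¹' E i) ∩ (T^[c] ⁻¹' E j)) ((hTm a (hE i)).inter (hTm c (hE j)))
      (by rw [preimage_inter, hEr, hEr]) (by filter_upwards [h] with ω hω using fun h' => hω h'.1 h'.2)
    filter_upwards [this] with ω hω h1 h2
    rw [Function.iterate_add_apply] at h1 h2
    exact hω ⟨h1, h2⟩
  have hmulm : ∀ k i ω, T^[k * m] ω ∈ E i ↔ ω ∈ E i := by
    intro k i ω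
    induction k with
    | zero => simp
    | succ k ih => rw [Nat.succ_mul, Function.iterate_add_apply, hinv', ih]
  have hposr : ∀ i r, ¬ ∀ᵐ ω ∂μ, T^[r] ω ∉ E i := by
    intro i r h
    have := hpull (r * m - r) _ (hTm r (hE i)) (hEr i r) h
    refine hpos i ?_
    filter_upwards [this] with ω hω h2
    refine hω ?_
    rw [mem_preimage, ← Function.iterate_add_apply, Nat.add_sub_cancel' (Nat.le_mul_of_pos_right r hm)]
    exact (hmulm r i ω).2 h2
  have hex : ∃ t, 1 ≤ t ∧ ∀ᵐ ω ∂μ, (T^[t] ω ∈ E i₀ ↔ ω ∈ E i₀) :=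
    ⟨m, hm, Eventually.of_forall (hinv i₀)⟩
  classical
  obtain ⟨t, ht, hmin⟩ : ∃ t, (1 ≤ t ∧ ∀ᵐ ω ∂μ, (T^[t] ω ∈ E i₀ ↔ ω ∈ E i₀)) ∧
      ∀ s, 1 ≤ s → s < t → ¬ ∀ᵐ ω ∂μ, (T^[s] ω ∈ E i₀ ↔ ω ∈ E i₀) :=
    ⟨Nat.find hex, Nat.find_spec hex, fun s h1 h2 h3 => Nat.find_min hex h2 ⟨h1, h3⟩⟩
  obtain ⟨ht1, hper⟩ := ht
  have hper1 : ∀ r, ∀ᵐ ω ∂μ, (T^[t + r] ω ∈ E i₀ ↔ T^[r] ω ∈ E i₀) := by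
    intro r
    have h1 := himp r t 0 i₀ i₀ (by filter_upwards [hper] with ω hω using hω.1)
    have h2 := himp r 0 t i₀ i₀ (by filter_upwards [hper] with ω hω using hω.2)
    filter_upwards [h1, h2] with ω h1 h2
    rw [zero_add] at h1 h2
    exact ⟨h1, h2⟩
  have hperk : ∀ k r, ∀ᵐ ω ∂μ, (T^[k * t + r] ω ∈ E i₀ ↔ T^[r] ω ∈ E i₀) := by
    intro k r
    induction k with
    | zero => simp
    | succ k ih =>
      filter_upwards [ih, hper1 (k * t + r)] with ω h1 h2
      rw [← h1, ← h2, Nat.succ_mul]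
      ring_nf
  have hdvd : t ∣ m := by
    by_contra hnd
    have hlt := Nat.mod_lt m ht1
    refine hmin (m % t) (Nat.pos_of_ne_zero fun h => hnd (Nat.dvd_of_mod_eq_zero h)) hlt ?_
    filter_upwards [hperk (m / t) (m % t)] with ω hω
    rw [← hω, Nat.div_add_mod', hinv]
  have htm : t ≤ m := Nat.le_of_dvd hm hdvd
  have hsep0 : ∀ s, 1 ≤ s → s < t → ∀ᵐ ω ∂μ, T^[0] ω ∈ E i₀ → T^[s] ω ∉ E i₀ := by
    intro s hs1 hst
    refine (hatom i₀ _ (hTm s (hE i₀)) (hEr i₀ s)).resolve_right fun h => hmin s hs1 hst ?_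
    have hstep : ∀ k, ∀ᵐ ω ∂μ, T^[s] ω ∈ E i₀ → T^[(k + 1) * s] ω ∈ E i₀ := by
      intro k
      induction k with
      | zero => simp
      | succ k ih =>
        filter_upwards [ih, himp ((k + 1) * s) 0 s i₀ i₀ h] with ω h1 h2 h3
        rw [Nat.succ_mul, add_comm]
        exact h2 (by rw [zero_add]; exact h1 h3)
    filter_upwards [h, hstep (m - 1)] with ω h1 h2
    refine ⟨fun h3 => ?_, h1⟩
    have := h2 h3
    rwa [Nat.sub_add_cancel hm, mul_comm, hmulm] at this
  have hsep : ∀ r s, r < t → s < t → r ≠ s →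
      ∀ᵐ ω ∂μ, T^[r] ω ∈ E i₀ → T^[s] ω ∉ E i₀ := by
    have key : ∀ r s, r < s → s < t → ∀ᵐ ω ∂μ, T^[r] ω ∈ E i₀ → T^[s] ω ∉ E i₀ := by
      intro r s hrs hst
      have := hdis r 0 (s - r) i₀ i₀ (hsep0 (s - r) (by omega) (by omega))
      rwa [zero_add, Nat.sub_add_cancel hrs.le] at this
    intro r s hr hs hne
    rcases lt_or_gt_of_ne hne with h | h
    · exact key r s h hs
    · filter_upwards [key s r h hr] with ω hω h1 h2 using hω h2 h1
  have hunion : ∀ᵐ ω ∂μ, ∃ r < m, T^[r] ω ∈ E i₀ := by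
    have hmeas : MeasurableSet {ω | ∃ r < m, T^[r] ω ∈ E i₀} := by
      have : {ω | ∃ r < m, T^[r] ω ∈ E i₀} = ⋃ r, ⋃ (_ : r < m), T^[r] ⁻¹' E i₀ := by
        ext; simp
      rw [this]
      exact MeasurableSet.iUnion fun r => MeasurableSet.iUnion fun _ => hTm r (hE i₀)
    refine (herg _ hmeas ?_).resolve_left fun h => hpos i₀ ?_
    · ext ω
      simp only [mem_preimage, mem_ofPred_eq, ← Function.iterate_succ_apply]
      constructor
      · rintro ⟨r, hr, h⟩
        by_cases hrm : r + 1 = m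
        · refine ⟨0, hm, ?_⟩
          rwa [Nat.succ_eq_add_one, hrm, hinv] at h
        · exact ⟨r + 1, by omega, h⟩
      · rintro ⟨r, hr, h⟩
        rcases r with _ | r
        · refine ⟨m - 1, by omega, ?_⟩
          rwa [Nat.succ_eq_add_one, Nat.sub_add_cancel hm, hinv]
        · exact ⟨r, by omega, h⟩
    · filter_upwards [h] with ω hω h2 using hω ⟨0, hm, h2⟩
  have hunion' : ∀ᵐ ω ∂μ, ∃ r < t, T^[r] ω ∈ E i₀ := by
    have hall : ∀ᵐ ω ∂μ, ∀ k r, (T^[k * t + r] ω ∈ E i₀ ↔ T^[r] ω ∈ E i₀) :=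
      ae_all_iff.2 fun k => ae_all_iff.2 fun r => hperk k r
    filter_upwards [hunion, hall] with ω ⟨r, _, h⟩ h2
    refine ⟨r % t, Nat.mod_lt _ ht1, ?_⟩
    rwa [← h2 (r / t), Nat.div_add_mod']
  have hin : ∀ i, ∃ r : Fin t, ∀ᵐ ω ∂μ, ω ∈ E i → T^[r] ω ∈ E i₀ := by
    intro i
    by_contra hno
    rw [not_exists] at hno
    have hall : ∀ᵐ ω ∂μ, ∀ r : Fin t, ω ∈ E i → T^[r] ω ∉ E i₀ := ae_all_iff.2 fun r =>
      (hatom i _ (hTm r (hE i₀)) (hEr i₀ r)).resolve_right (hno r)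
    refine hpos i ?_
    filter_upwards [hall, hunion'] with ω h1 ⟨r, hr, h2⟩ h3 using h1 ⟨r, hr⟩ h3 h2
  choose φ hφ using hin
  have hbij : Function.Bijective φ := by
    constructor
    · intro i j hij
      by_contra hne
      have key : ∀ k, φ k = φ i → ∀ᵐ ω ∂μ, ω ∈ E i₀ → T^[m - φ i] ω ∈ E k := by
        intro k hk
        refine (hatom i₀ _ (hTm _ (hE k)) (hEr k _)).resolve_left fun h => ?_
        have h1 := himp (m - φ i) 0 (φ k) k i₀ (hφ k)
        refine hposr k (m - φ i) ?_
        filter_upwards [h, h1] with ω h2 h3 h4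
        rw [zero_add, hk, Nat.add_sub_cancel' ((φ i).2.le.trans htm), hinv] at h3
        exact h2 (h3 h4) h4
      refine hpos i₀ ?_
      filter_upwards [key i rfl, key j hij.symm] with ω h1 h2 h3
      exact (disjoint_left.1 (hdisj i j hne)) (h1 h3) (h2 h3)
    · intro r
      by_contra! hno
      refine hposr i₀ r ?_
      have hall : ∀ᵐ ω ∂μ, ∀ i, ω ∈ E i → T^[φ i] ω ∈ E i₀ := ae_all_iff.2 hφ
      have hall2 : ∀ᵐ ω ∂μ, ∀ i, T^[φ i] ω ∈ E i₀ → T^[r] ω ∉ E i₀ := ae_all_iff.2 fun i =>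
        hsep _ _ (φ i).2 r.2 fun h => hno i (Fin.ext h)
      filter_upwards [hcover, hall, hall2] with ω ⟨i, hi⟩ h1 h2 using h2 i (h1 i hi)
  have hcard : Nat.card ι = t := by
    rw [Nat.card_eq_of_bijective φ hbij, Nat.card_fin]
  rw [hcard]
  exact ⟨ht1, hdvd, fun k => hperk k 0⟩

end AtomicCounting

section PathSpace

variable {S : Type}

lemma iterate_pathShift_apply (r : ℕ) (ω : ℕ → S) (n : ℕ) : pathShift^[r] ω n = ω (n + r) := by
  induction r generalizing ω with
  | zero => rfl
  | succ r ih => rw [Function.iterate_succ_apply, ih]; rfl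

/-- The event that a path agrees with `s` up to time `n`. -/
def prefixEvent (n : ℕ) (s : ℕ → S) : Set (ℕ → S) := {ω | ∀ k ≤ n, ω k = s k}

lemma preimage_frestrictLe_singleton (n : ℕ) (b : Finset.Iic n → S) :
    Preorder.frestrictLe (π := fun _ => S) n ⁻¹' {b}
      = prefixEvent n fun k => b ⟨min k n, Finset.mem_Iic.2 (min_le_right k n)⟩ := by
  ext ω
  simp only [mem_preimage, mem_singleton_iff, prefixEvent, mem_ofPred_eq, funext_iff]
  constructor
  · intro h k hk
    rw [← h]
    simp [hk]
  · rintro h ⟨k, hk⟩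
    have hk' := Finset.mem_Iic.1 hk
    have := h k hk'
    simp only [min_eq_left hk'] at this
    exact this

variable [MeasurableSpace S]

lemma measurable_pathShift : Measurable (pathShift : (ℕ → S) → ℕ → S) :=
  measurable_pi_lambda _ fun n => measurable_pi_apply (n + 1)

lemma measurableSet_prefixEvent [MeasurableSingletonClass S] (n : ℕ) (s : ℕ → S) :
    MeasurableSet (prefixEvent n s) := by
  have : prefixEvent n s = ⋂ k, ⋂ (_ : k ≤ n), (fun ω : ℕ → S => ω k) ⁻¹' {s k} := by
    ext; simp [prefixEvent]
  rw [this]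
  exact MeasurableSet.iInter fun k => MeasurableSet.iInter fun _ =>
    measurable_pi_apply k (measurableSet_singleton _)

lemma map_frestrictLe_eq [MeasurableSingletonClass S] [Countable S] {μ ν : Measure (ℕ → S)} {n : ℕ}
    (h : ∀ s, μ (prefixEvent n s) = ν (prefixEvent n s)) :
    μ.map (Preorder.frestrictLe (π := fun _ => S) n)
      = ν.map (Preorder.frestrictLe (π := fun _ => S) n) := by
  refine Measure.ext_of_singleton fun b => ?_
  rw [Measure.map_apply (Preorder.measurable_frestrictLe n) (measurableSet_singleton _),
    Measure.map_apply (Preorder.measurable_frestrictLe n) (measurableSet_singleton _),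
    preimage_frestrictLe_singleton, h]

lemma measure_eq_of_prefixEvent [MeasurableSingletonClass S] [Countable S] {μ ν : Measure (ℕ → S)}
    [IsFiniteMeasure ν]
    (h : ∀ n s, μ (prefixEvent n s) = ν (prefixEvent n s)) : μ = ν := by
  have hν : IsProjectiveMeasureFamily (α := fun _ => S) fun I : Finset ℕ => ν.map (Finset.restrict (π := fun _ => S) I) := by
    intro I J hJI
    rw [Measure.map_map (Finset.measurable_restrict₂ hJI) (Finset.measurable_restrict I)]
    rfl
  have h1 : IsProjectiveLimit (α := fun _ => S) ν fun I : Finset ℕ => ν.map (Finset.restrict (π := fun _ => S) I) :=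
    fun I => rfl
  have h2 : IsProjectiveLimit (α := fun _ => S) μ fun I : Finset ℕ => ν.map (Finset.restrict (π := fun _ => S) I) :=
    (isProjectiveLimit_nat_iff hν μ).2 fun n => map_frestrictLe_eq (h n)
  exact h2.unique h1

end PathSpace

namespace MarkovChain

section MarkovProperty

variable {S : Type} [MeasurableSpace S] (X : MarkovChain S)

instance : IsProbabilityMeasure X.μ := X.μ_prob

/-- `X.Reach n i j` holds if there is a path of positive probability of length `n` from `i`
to `j`. -/
def Reach : ℕ → S → S → Prop
  | 0, i, j => i = j
  | n + 1, i, j => ∃ k, Reach n i k ∧ 0 < X.P k j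

lemma reach_of_Pn_pos {n : ℕ} {i j : S} (h : 0 < X.Pn n i j) : X.Reach n i j := by
  induction n generalizing j with
  | zero =>
    by_contra hij
    have hij' : i ≠ j := hij
    simp [Pn, hij'] at h
  | succ n ih =>
    rw [Pn] at h
    by_contra hno
    refine h.not_ge (tsum_nonpos fun k => ?_)
    by_contra! hk
    have hP : 0 < X.P k j := (X.P_nonneg k j).lt_of_ne fun h0 => by simp [← h0] at hk
    exact hno ⟨k, ih (pos_of_mul_pos_left hk hP.le), hP⟩

variable {X} in
lemma Reach.trans {a c : ℕ} {i j k : S} (h1 : X.Reach a i j) (h2 : X.Reach c j k) :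
    X.Reach (a + c) i k := by
  induction c generalizing k with
  | zero => cases (h2 : j = k); exact h1
  | succ c ih =>
    obtain ⟨l, hl, hP⟩ := h2
    exact ⟨l, ih hl, hP⟩

lemma eventually_reach_self (hap : X.Aperiodic) (j : S) : ∃ N, ∀ n ≥ N, X.Reach n j j := by
  obtain ⟨N, hN⟩ := Nat.exists_mem_closure_of_ge {n | X.Reach n j j}
  refine ⟨N, fun n hn => ?_⟩
  have hgcd : Nat.setGcd {n | X.Reach n j j} = 1 :=
    hap j _ fun n _ hpos => Nat.setGcd_dvd_of_mem (X.reach_of_Pn_pos hpos)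
  have hmem := hN n hn (hgcd ▸ one_dvd n)
  clear hn
  induction hmem using AddSubmonoid.closure_induction with
  | mem x hx => exact hx
  | zero => rfl
  | add x y _ _ hx hy => exact hx.trans hy

lemma measure_prefixEvent (n : ℕ) (s : ℕ → S) :
    X.μ (prefixEvent n s)
      = ENNReal.ofReal (X.init (s 0) * ∏ k ∈ Finset.range n, X.P (s k) (s (k + 1))) :=
  X.μ_cylinder n s

lemma exists_prefixEvent_of_reach {i : S} (hi : 0 < X.init i) {n : ℕ} {j : S}
    (h : X.Reach n i j) : ∃ s, s n = j ∧ X.μ (prefixEvent n s) ≠ 0 := by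
  suffices ∃ s : ℕ → S, s n = j ∧
      0 < X.init (s 0) * ∏ k ∈ Finset.range n, X.P (s k) (s (k + 1)) by
    obtain ⟨s, hs, hpos⟩ := this
    exact ⟨s, hs, by rw [measure_prefixEvent]; simpa using hpos⟩
  induction n generalizing j with
  | zero => exact ⟨fun _ => i, h, by simpa using hi⟩
  | succ n ih =>
    obtain ⟨k, hk, hP⟩ := h
    obtain ⟨s, hs, hpos⟩ := ih hk
    refine ⟨fun l => if l ≤ n then s l else j, by simp, ?_⟩
    rw [Finset.prod_range_succ, ← mul_assoc]
    refine mul_pos ?_ (by simpa [hs] using hP)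
    have hprod : ∏ l ∈ Finset.range n, X.P (if l ≤ n then s l else j)
        (if l + 1 ≤ n then s (l + 1) else j) = ∏ l ∈ Finset.range n, X.P (s l) (s (l + 1)) := by
      refine Finset.prod_congr rfl fun l hl => ?_
      have := Finset.mem_range.1 hl
      rw [if_pos this.le, if_pos (Nat.succ_le_of_lt this)]
    simpa only [Nat.zero_le, if_true, hprod] using hpos

/-- Every state is visited with positive probability at some time divisible by `m`. -/
lemma exists_prefixEvent_ne_zero (hirr : X.Irreducible) (hap : X.Aperiodic) {m : ℕ} (hm : 1 ≤ m)
    (x : S) : ∃ n s, s (n * m) = x ∧ X.μ (prefixEvent (n * m) s) ≠ 0 := by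
  obtain ⟨i, hi⟩ : ∃ i, 0 < X.init i := by
    by_contra! h
    have h0 : X.init = 0 := funext fun i => le_antisymm (h i) (X.init_nonneg i)
    have hsum := X.init_hasSum
    rw [h0] at hsum
    exact zero_ne_one (hasSum_zero.unique hsum)
  obtain ⟨n₀, h₀⟩ := hirr i x
  obtain ⟨N, hN⟩ := X.eventually_reach_self hap x
  have hle : n₀ + N ≤ (n₀ + N) * m := Nat.le_mul_of_pos_right _ hm
  refine ⟨n₀ + N, X.exists_prefixEvent_of_reach hi ?_⟩
  have := (X.reach_of_Pn_pos h₀).trans (hN ((n₀ + N) * m - n₀) (by omega))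
  rwa [Nat.add_sub_cancel' (by omega)] at this

lemma measure_prefixEvent_inter (n k : ℕ) (s t : ℕ → S) (h : t 0 = s n) :
    X.μ (prefixEvent n s ∩ pathShift^[n] ⁻¹' prefixEvent k t)
      = X.μ (prefixEvent n s)
        * ENNReal.ofReal (∏ l ∈ Finset.range k, X.P (t l) (t (l + 1))) := by
  set u : ℕ → S := fun l => if l ≤ n then s l else t (l - n) with hu
  have hu1 : ∀ l ≤ n, u l = s l := fun l hl => by simp [hu, hl]
  have hu2 : ∀ l, u (n + l) = t l := fun l => by
    rcases Nat.eq_zero_or_pos l with rfl | hl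
    · simp [hu, h]
    · simp [hu, show ¬ l = 0 by omega]
  have hset : prefixEvent n s ∩ pathShift^[n] ⁻¹' prefixEvent k t = prefixEvent (n + k) u := by
    ext ω
    simp only [prefixEvent, mem_inter_iff, mem_preimage, mem_ofPred_eq, iterate_pathShift_apply]
    constructor
    · rintro ⟨h1, h2⟩ l hl
      rcases le_total l n with hln | hln
      · rw [h1 l hln, hu1 l hln]
      · obtain ⟨d, rfl⟩ := Nat.exists_eq_add_of_le hln
        rw [hu2, ← h2 d (by omega), add_comm]
    · intro h1
      refine ⟨fun l hl => by rw [h1 l (by omega), hu1 l hl], fun l hl => ?_⟩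
      rw [add_comm, h1 _ (by omega), hu2]
  have hP : 0 ≤ X.init (s 0) * ∏ l ∈ Finset.range n, X.P (s l) (s (l + 1)) :=
    mul_nonneg (X.init_nonneg _) (Finset.prod_nonneg fun l _ => X.P_nonneg _ _)
  rw [hset, measure_prefixEvent, measure_prefixEvent, ← ENNReal.ofReal_mul hP,
    Finset.prod_range_add, mul_assoc, hu1 0 (Nat.zero_le n)]
  have h1 : ∏ l ∈ Finset.range n, X.P (u l) (u (l + 1))
      = ∏ l ∈ Finset.range n, X.P (s l) (s (l + 1)) := Finset.prod_congr rfl fun l hl => by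
    have := Finset.mem_range.1 hl
    rw [hu1 l this.le, hu1 (l + 1) this]
  have h2 : ∏ l ∈ Finset.range k, X.P (u (n + l)) (u (n + l + 1))
      = ∏ l ∈ Finset.range k, X.P (t l) (t (l + 1)) := Finset.prod_congr rfl fun l _ => by
    rw [hu2, add_assoc, hu2]
  rw [h1, h2]

variable [MeasurableSingletonClass S] [Countable S]

/-- The Markov property: there is a family of laws of the chain started from each state. -/
lemma exists_markov_family (hirr : X.Irreducible) (hap : X.Aperiodic) :
    ∃ ν : S → Measure (ℕ → S), (∀ x, IsProbabilityMeasure (ν x)) ∧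
      ∀ (n : ℕ) (s : ℕ → S) (B : Set (ℕ → S)), MeasurableSet B →
        X.μ (prefixEvent n s ∩ pathShift^[n] ⁻¹' B) = X.μ (prefixEvent n s) * ν (s n) B := by
  have hex : ∀ x, ∃ n s, s n = x ∧ X.μ (prefixEvent n s) ≠ 0 := fun x => by
    obtain ⟨n, s, h⟩ := X.exists_prefixEvent_ne_zero hirr hap le_rfl x
    exact ⟨n * 1, s, h⟩
  choose N σ hσ hpos using hex
  have hsh : ∀ n : ℕ, Measurable (pathShift^[n] : (ℕ → S) → ℕ → S) :=
    fun n => measurable_pathShift.iterate n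
  have happly : ∀ (n : ℕ) (s : ℕ → S) {B : Set (ℕ → S)}, MeasurableSet B →
      (X.μ.restrict (prefixEvent n s)).map pathShift^[n] B
        = X.μ (prefixEvent n s ∩ pathShift^[n] ⁻¹' B) := by
    intro n s B hB
    rw [Measure.map_apply (hsh n) hB, Measure.restrict_apply (hsh n hB), inter_comm]
  refine ⟨fun x => (X.μ (prefixEvent (N x) (σ x)))⁻¹ •
    (X.μ.restrict (prefixEvent (N x) (σ x))).map pathShift^[N x], fun x => ⟨?_⟩, ?_⟩
  · rw [Measure.smul_apply, happly _ _ MeasurableSet.univ, preimage_univ, inter_univ, smul_eq_mul]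
    exact ENNReal.inv_mul_cancel (hpos x) (measure_ne_top _ _)
  · intro n s B hB
    have hcancel := ENNReal.mul_inv_cancel (hpos (s n)) (measure_ne_top X.μ _)
    have key : X.μ (prefixEvent (N (s n)) (σ (s n))) •
        (X.μ.restrict (prefixEvent n s)).map pathShift^[n] =
        X.μ (prefixEvent n s) • (X.μ.restrict (prefixEvent (N (s n)) (σ (s n)))).map
          pathShift^[N (s n)] := by
      have : IsFiniteMeasure (X.μ (prefixEvent n s) •
          (X.μ.restrict (prefixEvent (N (s n)) (σ (s n)))).map pathShift^[N (s n)]) :=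
        Measure.smul_finite _ (measure_ne_top _ _)
      refine measure_eq_of_prefixEvent fun k t => ?_
      simp only [Measure.smul_apply, happly _ _ (measurableSet_prefixEvent k t), smul_eq_mul]
      by_cases ht : t 0 = s n
      · rw [X.measure_prefixEvent_inter n k s t ht,
          X.measure_prefixEvent_inter _ k _ t (ht.trans (hσ _).symm)]
        ring
      · have hempty : ∀ (n' : ℕ) (s' : ℕ → S), s' n' = s n →
            prefixEvent n' s' ∩ pathShift^[n'] ⁻¹' prefixEvent k t = ∅ := by
          intro n' s' hs'
          ext ω
          simp only [prefixEvent, mem_inter_iff, mem_preimage, mem_ofPred_eq,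
            iterate_pathShift_apply, mem_empty_iff_false, iff_false, not_and]
          intro h1 h2
          have := h2 0 (Nat.zero_le k)
          rw [zero_add, h1 n' le_rfl, hs'] at this
          exact ht this.symm
        rw [hempty n s rfl, hempty _ _ (hσ _)]
        simp
    have := congrArg (fun ρ => ρ B) key
    simp only [Measure.smul_apply, happly _ _ hB, smul_eq_mul] at this ⊢
    rw [mul_left_comm, ← this, ← mul_assoc, mul_comm (_⁻¹), hcancel, one_mul]

/-- For `m`-step invariant events, being null is preserved by the shift. -/
lemma ae_pathShift_notMem_of_invariant (hirr : X.Irreducible) (hap : X.Aperiodic) {m : ℕ}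
    (hm : 1 ≤ m) (G : Set (ℕ → S)) (hG : MeasurableSet G) (hinv : pathShift^[m] ⁻¹' G = G)
    (h0 : ∀ᵐ ω ∂X.μ, ω ∉ G) : ∀ᵐ ω ∂X.μ, pathShift ω ∉ G := by
  obtain ⟨ν, -, hν⟩ := X.exists_markov_family hirr hap
  have hinvk : ∀ k, pathShift^[k * m] ⁻¹' G = G := by
    intro k
    induction k with
    | zero => simp
    | succ k ih => rw [Nat.succ_mul, Function.iterate_add, preimage_comp, ih, hinv]
  have hν0 : ∀ x, ν x G = 0 := by
    intro x
    obtain ⟨n, s, rfl, hpos⟩ := X.exists_prefixEvent_ne_zero hirr hap hm x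
    have h1 := hν (n * m) s G hG
    rw [hinvk, measure_mono_null inter_subset_right (measure_eq_zero_iff_ae_notMem.2 h0)] at h1
    exact (mul_eq_zero.1 h1.symm).resolve_left hpos
  have hcover : pathShift ⁻¹' G ⊆ ⋃ b : S × S,
      (prefixEvent 1 fun k => if k = 0 then b.1 else b.2) ∩ pathShift^[1] ⁻¹' G := by
    intro ω hω
    refine mem_iUnion.2 ⟨(ω 0, ω 1), fun k hk => ?_, hω⟩
    interval_cases k <;> rfl
  refine measure_eq_zero_iff_ae_notMem.1 (measure_mono_null hcover ?_)
  rw [measure_iUnion_null_iff]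
  intro b
  rw [hν _ _ _ hG, hν0, mul_zero]

/-- Every `m`-step invariant event is, up to a null event, the event that the `m`-step chain
eventually stays in some set of states, and its complement is the event that the chain eventually
leaves that set. -/
lemma exists_set_of_invariant (hirr : X.Irreducible) (hap : X.Aperiodic) {m : ℕ} (hm : 1 ≤ m)
    (G : Set (ℕ → S)) (hG : MeasurableSet G) (hinv : pathShift^[m] ⁻¹' G = G) :
    ∃ D : Set S, ∀ᵐ ω ∂X.μ, (ω ∈ G → ω ∈ X.L m D) ∧ (ω ∉ G → ω ∉ X.U m D) := by
  obtain ⟨ν, hνp, hν⟩ := X.exists_markov_family hirr hap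
  have hinvk : ∀ k, pathShift^[k * m] ⁻¹' G = G := by
    intro k
    induction k with
    | zero => simp
    | succ k ih => rw [Nat.succ_mul, Function.iterate_add, preimage_comp, ih, hinv]
  set h : S → ℝ := fun x => (ν x).real G with hh
  have hmeas : ∀ n : ℕ, Measurable fun ω : ℕ → S => h (ω n) := fun n =>
    (measurable_of_countable h).comp (measurable_pi_apply n)
  have hbd : ∀ x, ‖h x‖ ≤ 1 := fun x => by
    rw [Real.norm_of_nonneg measureReal_nonneg]
    exact measureReal_le_one
  have hint : ∀ n : ℕ, Integrable (fun ω : ℕ → S => h (ω n)) X.μ := fun n =>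
    Integrable.of_bound (hmeas n).aestronglyMeasurable 1 (Eventually.of_forall fun ω => hbd _)
  have hintG : Integrable (G.indicator fun _ => (1 : ℝ)) X.μ :=
    (integrable_const 1).indicator hG
  set ℱ : Filtration ℕ (MeasurableSpace.pi : MeasurableSpace (ℕ → S)) :=
    Filtration.piLE (X := fun _ : ℕ => S)
  have hℱ : ∀ n, ℱ n = MeasurableSpace.pi.comap (Preorder.frestrictLe (π := fun _ => S) n) :=
    fun n => Filtration.piLE_eq_comap_frestrictLe n
  have hcond : ∀ k : ℕ, (fun ω : ℕ → S => h (ω (k * m)))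
      =ᵐ[X.μ] X.μ[G.indicator fun _ => (1 : ℝ) | ℱ (k * m)] := by
    intro k
    refine ae_eq_condExp_of_forall_setIntegral_eq (ℱ.le _) hintG
      (fun s _ _ => (hint _).integrableOn) (fun A hA _ => ?_) ?_
    · rw [hℱ] at hA
      obtain ⟨B, hB, rfl⟩ := hA
      have hmap : (X.μ.withDensity fun ω => ν (ω (k * m)) G).map
          (Preorder.frestrictLe (π := fun _ => S) (k * m)) = (X.μ.restrict G).map
          (Preorder.frestrictLe (π := fun _ => S) (k * m)) := by
        refine map_frestrictLe_eq fun s => ?_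
        rw [Measure.restrict_apply (measurableSet_prefixEvent _ _),
          withDensity_apply _ (measurableSet_prefixEvent _ _)]
        have h1 := hν (k * m) s G hG
        rw [hinvk] at h1
        rw [h1, setLIntegral_congr_fun (g := fun _ => ν (s (k * m)) G)
          (measurableSet_prefixEvent _ _) (fun ω hω => by simp only [hω _ le_rfl]),
          setLIntegral_const, mul_comm]
      have h2 := congrArg (fun ρ => ρ B) hmap
      have hfm := Preorder.measurable_frestrictLe (X := fun _ : ℕ => S) (k * m)
      simp only [Measure.map_apply hfm hB, Measure.restrict_apply (hfm hB),
        withDensity_apply _ (hfm hB)] at h2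
      rw [integral_indicator_const _ hG, integral_eq_lintegral_of_nonneg_ae
        (Eventually.of_forall fun ω => measureReal_nonneg) (hmeas _).aestronglyMeasurable.restrict]
      have hof : ∀ x, ENNReal.ofReal ((ν x).real G) = ν x G := fun x => ofReal_measureReal
      simp only [hof]
      rw [h2, smul_eq_mul, mul_one, measureReal_restrict_apply hG, inter_comm]
      rfl
    · have hsm : Measurable[ℱ (k * m)] fun ω : ℕ → S => h (ω (k * m)) := by
        rw [hℱ]
        exact (measurable_of_countable fun b : Finset.Iic (k * m) → S =>
          h (b ⟨k * m, Finset.mem_Iic.2 le_rfl⟩)).comp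
          (comap_measurable (Preorder.frestrictLe (π := fun _ => S) (k * m)))
      exact hsm.stronglyMeasurable.aestronglyMeasurable
  have hsup : (MeasurableSpace.pi : MeasurableSpace (ℕ → S)) ≤ ⨆ n, ℱ n := by
    refine iSup_le fun n => le_trans ?_ (le_iSup _ n)
    rw [hℱ]
    refine Measurable.comap_le ?_
    exact (measurable_pi_apply (⟨n, Finset.mem_Iic.2 le_rfl⟩ : Finset.Iic n)).comp
      (comap_measurable (Preorder.frestrictLe (π := fun _ => S) n))
  have hlim := hintG.tendsto_ae_condExp (ℱ := ℱ)
    (Measurable.stronglyMeasurable ((measurable_const.indicator hG).mono hsup le_rfl))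
  refine ⟨{x | 1 / 2 < h x}, ?_⟩
  filter_upwards [hlim, ae_all_iff.2 hcond] with ω hω hc
  have hω' : Tendsto (fun k : ℕ => h (ω (k * m))) atTop (nhds (G.indicator (fun _ => (1 : ℝ)) ω)) := by
    refine (hω.comp (tendsto_id.atTop_mul_const' hm)).congr fun k => ?_
    exact (hc k).symm
  constructor
  · intro hG
    rw [indicator_of_mem hG] at hω'
    obtain ⟨n, hn⟩ := eventually_atTop.1 (hω'.eventually (lt_mem_nhds (by norm_num : (1 / 2 : ℝ) < 1)))
    exact ⟨n, hn⟩
  · intro hG hU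
    rw [indicator_of_notMem hG] at hω'
    obtain ⟨n, hn⟩ := eventually_atTop.1 (hω'.eventually (gt_mem_nhds (by norm_num : (0 : ℝ) < 1 / 2)))
    obtain ⟨k, hk, hkD⟩ := hU n
    exact lt_asymm (hn k hk) hkD

end MarkovProperty

section AlmostClosedSets

variable {S : Type} [MeasurableSpace S] (X : MarkovChain S)

lemma L_subset_U (m : ℕ) (C : Set S) : X.L m C ⊆ X.U m C := by
  rintro ω ⟨N, hN⟩ n
  exact ⟨max n N, le_max_left _ _, hN _ (le_max_right _ _)⟩

lemma U_mul_subset {k : ℕ} (hk : 1 ≤ k) (b : ℕ) (C : Set S) : X.U (k * b) C ⊆ X.U b C := by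
  intro ω h n
  obtain ⟨l, hl, hC⟩ := h n
  exact ⟨l * k, hl.trans (Nat.le_mul_of_pos_right l hk), by rwa [mul_assoc]⟩

lemma L_subset_mul {k : ℕ} (hk : 1 ≤ k) (b : ℕ) (C : Set S) : X.L b C ⊆ X.L (k * b) C := by
  rintro ω ⟨N, hN⟩
  exact ⟨N, fun l hl => by
    rw [← mul_assoc]; exact hN _ (hl.trans (Nat.le_mul_of_pos_right l hk))⟩

variable {X} in
lemma U_mono {m : ℕ} {A B : Set S} (h : A ⊆ B) : X.U m A ⊆ X.U m B :=
  fun _ hU n => let ⟨l, hl, hA⟩ := hU n; ⟨l, hl, h hA⟩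

variable {X} in
lemma mem_L_inter {m : ℕ} {A B : Set S} {ω : ℕ → S} (hA : ω ∈ X.L m A) (hB : ω ∈ X.L m B) :
    ω ∈ X.L m (A ∩ B) := by
  obtain ⟨N, hN⟩ := hA
  obtain ⟨M, hM⟩ := hB
  exact ⟨max N M, fun l hl =>
    ⟨hN l ((le_max_left _ _).trans hl), hM l ((le_max_right _ _).trans hl)⟩⟩

variable {X} in
lemma mem_L_compl {m : ℕ} {A : Set S} {ω : ℕ → S} (hA : ω ∉ X.U m A) : ω ∈ X.L m Aᶜ := by
  by_contra h
  refine hA fun n => ?_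
  by_contra hno
  exact h ⟨n, fun k hk hA' => hno ⟨k, hk, hA'⟩⟩

variable {X} in
lemma notMem_U_of_disjoint {m : ℕ} {A B : Set S} (hd : Disjoint A B) {ω : ℕ → S}
    (hA : ω ∈ X.L m A) : ω ∉ X.U m B := by
  obtain ⟨N, hN⟩ := hA
  intro hU
  obtain ⟨k, hk, hB⟩ := hU N
  exact disjoint_left.1 hd (hN k hk) hB

lemma disjoint_L {m : ℕ} {A B : Set S} (hd : Disjoint A B) : Disjoint (X.L m A) (X.L m B) :=
  disjoint_left.2 fun _ hA hB => notMem_U_of_disjoint hd hA (X.L_subset_U m B hB)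

lemma mem_L_iterate_iff (m r : ℕ) (C : Set S) (ω : ℕ → S) :
    pathShift^[r] ω ∈ X.L m C ↔ ∃ n, ∀ k, n ≤ k → ω (k * m + r) ∈ C := by
  simp only [L, mem_ofPred_eq, iterate_pathShift_apply]

lemma mem_U_iterate_iff (m r : ℕ) (C : Set S) (ω : ℕ → S) :
    pathShift^[r] ω ∈ X.U m C ↔ ∀ n, ∃ k, n ≤ k ∧ ω (k * m + r) ∈ C := by
  simp only [U, mem_ofPred_eq, iterate_pathShift_apply]

lemma preimage_iterate_L (m : ℕ) (C : Set S) : pathShift^[m] ⁻¹' X.L m C = X.L m C := by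
  ext ω
  rw [mem_preimage, mem_L_iterate_iff]
  constructor
  · rintro ⟨N, hN⟩
    refine ⟨N + 1, fun k hk => ?_⟩
    obtain ⟨d, rfl⟩ := Nat.exists_eq_add_of_le hk
    have := hN (N + d) (by omega)
    rwa [← Nat.succ_mul, show (N + d).succ = N + 1 + d by omega] at this
  · rintro ⟨N, hN⟩
    refine ⟨N, fun k hk => ?_⟩
    rw [← Nat.succ_mul]
    exact hN _ (by omega)

lemma preimage_iterate_U (m : ℕ) (C : Set S) : pathShift^[m] ⁻¹' X.U m C = X.U m C := by
  ext ω
  rw [mem_preimage, mem_U_iterate_iff]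
  constructor
  · intro h n
    obtain ⟨k, hk, hC⟩ := h n
    exact ⟨k + 1, by omega, by rwa [Nat.succ_mul]⟩
  · intro h n
    obtain ⟨k, hk, hC⟩ := h (n + 1)
    refine ⟨k - 1, by omega, ?_⟩
    rwa [← Nat.succ_mul, Nat.succ_eq_add_one, Nat.sub_add_cancel (by omega)]

lemma almostClosed_iff {m : ℕ} {C : Set S} : X.AlmostClosed m C ↔
    (∀ᵐ ω ∂X.μ, ω ∈ X.U m C → ω ∈ X.L m C) ∧ ¬ ∀ᵐ ω ∂X.μ, ω ∉ X.L m C := by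
  have h1 : X.Regular m C ↔ ∀ᵐ ω ∂X.μ, ω ∈ X.U m C → ω ∈ X.L m C := by
    rw [Regular, measure_eq_zero_iff_ae_notMem]
    refine eventually_congr (Eventually.of_forall fun ω => ?_)
    have := fun h : ω ∈ X.L m C => X.L_subset_U m C h
    rw [mem_symmDiff]
    tauto
  rw [AlmostClosed, h1, Transient, measure_eq_zero_iff_ae_notMem]
  refine and_congr_right fun h => not_congr ⟨fun h2 => ?_, fun h2 => ?_⟩
  · filter_upwards [h2] with ω hω hL using hω (X.L_subset_U m C hL)
  · filter_upwards [h, h2] with ω h hω hU using hω (h hU)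

variable {X}

lemma AlmostClosed.ae_mem_L {m : ℕ} {C : Set S} (h : X.AlmostClosed m C) :
    ∀ᵐ ω ∂X.μ, ω ∈ X.U m C → ω ∈ X.L m C := (X.almostClosed_iff.1 h).1

lemma AlmostClosed.not_ae_notMem {m : ℕ} {C : Set S} (h : X.AlmostClosed m C) :
    ¬ ∀ᵐ ω ∂X.μ, ω ∉ X.L m C := (X.almostClosed_iff.1 h).2

lemma AlmostClosed.mul {b : ℕ} {C : Set S} (h : X.AlmostClosed b C) {k : ℕ} (hk : 1 ≤ k) :
    X.AlmostClosed (k * b) C := by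
  rw [almostClosed_iff]
  constructor
  · filter_upwards [h.ae_mem_L] with ω hω hU
    exact X.L_subset_mul hk b C (hω (X.U_mul_subset hk b C hU))
  · intro h2
    refine h.not_ae_notMem ?_
    filter_upwards [h2] with ω hω hL using hω (X.L_subset_mul hk b C hL)

lemma AlmostClosed.inter {m : ℕ} {A B : Set S} (hA : X.AlmostClosed m A)
    (hB : X.AlmostClosed m B) (h : ¬ ∀ᵐ ω ∂X.μ, ω ∈ X.L m A → ω ∉ X.L m B) :
    X.AlmostClosed m (A ∩ B) := by
  rw [almostClosed_iff]
  constructor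
  · filter_upwards [hA.ae_mem_L, hB.ae_mem_L] with ω h1 h2 hU
    exact mem_L_inter (h1 (U_mono inter_subset_left hU)) (h2 (U_mono inter_subset_right hU))
  · intro h2
    refine h ?_
    filter_upwards [h2] with ω hω h3 h4 using hω (mem_L_inter h3 h4)

/-- A Blackwell decomposition for the `q * b`-step chain all of whose members are atomic, and
almost closed for the `b`-step chain, is a Blackwell decomposition for the `b`-step chain. -/
lemma IsBlackwell.of_mul {b q : ℕ} (hq : 1 ≤ q) {𝒞 : Set (Set S)}
    (h𝒞 : X.IsBlackwell (q * b) 𝒞) (hatom : ∀ C ∈ 𝒞, X.Atomic (q * b) C)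
    (hAC : ∀ C ∈ 𝒞, X.AlmostClosed b C) : X.IsBlackwell b 𝒞 := by
  have hatom' : ∀ C ∈ 𝒞, X.Atomic b C := fun C hC => ⟨hAC C hC, by
    rintro ⟨A, B, hA, hB, hAB, h1, h2⟩
    exact (hatom C hC).2 ⟨A, B, hA, hB, hAB, h1.mul hq, h2.mul hq⟩⟩
  refine ⟨h𝒞.countable, hAC, h𝒞.disjoint, fun C hC _ _ h => (h (hatom' C hC)).elim,
    fun C hC h => (h (hatom' C hC)).elim, fun C hC h => (h (hatom' C hC)).elim, ?_⟩
  rw [← h𝒞.sum_L_eq_one]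
  refine tsum_congr fun C => measure_congr ?_
  filter_upwards [(hAC C C.2).ae_mem_L] with ω hω
  refine propext ⟨fun h => X.L_subset_mul hq b C h, fun h => hω ?_⟩
  exact X.U_mul_subset hq b C (X.L_subset_U _ _ h)

lemma exists_pairwise_disjoint_of_not_atomic {m : ℕ} (n : ℕ) {C : Set S}
    (hC : X.AlmostClosed m C) (h : ∀ A ⊆ C, ¬ X.Atomic m A) :
    ∃ A : Fin (n + 1) → Set S, (∀ i, A i ⊆ C ∧ X.AlmostClosed m (A i)) ∧
      Pairwise fun i j => Disjoint (A i) (A j) := by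
  induction n generalizing C with
  | zero =>
    exact ⟨fun _ => C, fun _ => ⟨subset_rfl, hC⟩, fun i j hij => (hij (by omega)).elim⟩
  | succ n ih =>
    have hnot : ∃ A B : Set S, A ⊆ C ∧ B ⊆ C ∧ Disjoint A B ∧
        X.AlmostClosed m A ∧ X.AlmostClosed m B := by
      by_contra hno
      exact h C subset_rfl ⟨hC, hno⟩
    obtain ⟨A, B, hAC, hBC, hAB, hA, hB⟩ := hnot
    obtain ⟨F, hF, hFd⟩ := ih hA fun A' hA' => h A' (hA'.trans hAC)
    have hBF : ∀ i, Disjoint B (F i) := fun i => hAB.symm.mono_right (hF i).1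
    refine ⟨Fin.cons B F, fun i => ?_, fun i j => ?_⟩
    · refine Fin.cases ⟨hBC, hB⟩ (fun i => ?_) i
      exact ⟨(hF i).1.trans hAC, (hF i).2⟩
    · refine Fin.cases (Fin.cases (fun h => (h rfl).elim) (fun j _ => ?_) j)
        (fun i => Fin.cases (fun _ => ?_) (fun j hij => ?_) j) i
      · exact hBF j
      · exact (hBF i).symm
      · exact hFd fun h => hij (congrArg Fin.succ h)

variable [MeasurableSingletonClass S] [Countable S]

lemma measurableSet_L (X : MarkovChain S) (m : ℕ) (C : Set S) : MeasurableSet (X.L m C) := by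
  have : X.L m C = ⋃ n, ⋂ k, ⋂ (_ : n ≤ k), (fun ω : ℕ → S => ω (k * m)) ⁻¹' C := by
    ext; simp [L]
  rw [this]
  exact MeasurableSet.iUnion fun n => MeasurableSet.iInter fun k => MeasurableSet.iInter fun _ =>
    measurable_pi_apply (k * m) (Set.to_countable C).measurableSet

lemma measurableSet_U (X : MarkovChain S) (m : ℕ) (C : Set S) : MeasurableSet (X.U m C) := by
  have : X.U m C = ⋂ n, ⋃ k, ⋃ (_ : n ≤ k), (fun ω : ℕ → S => ω (k * m)) ⁻¹' C := by
    ext; simp [U]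
  rw [this]
  exact MeasurableSet.iInter fun n => MeasurableSet.iUnion fun k => MeasurableSet.iUnion fun _ =>
    measurable_pi_apply (k * m) (Set.to_countable C).measurableSet

/-- The event attached to an atomic set is an atom of the `m`-step invariant `σ`-algebra. -/
lemma Atomic.ae_notMem_or_ae_mem (hirr : X.Irreducible) (hap : X.Aperiodic) {m : ℕ} (hm : 1 ≤ m)
    {C : Set S} (hC : X.Atomic m C) (G : Set (ℕ → S)) (hG : MeasurableSet G)
    (hinv : pathShift^[m] ⁻¹' G = G) :
    (∀ᵐ ω ∂X.μ, ω ∈ X.L m C → ω ∉ G) ∨ ∀ᵐ ω ∂X.μ, ω ∈ X.L m C → ω ∈ G := by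
  obtain ⟨D, hD⟩ := X.exists_set_of_invariant hirr hap hm G hG hinv
  by_contra! hno
  obtain ⟨h1, h2⟩ := hno
  refine hC.2 ⟨C ∩ D, C ∩ Dᶜ, inter_subset_left, inter_subset_left,
    disjoint_compl_right.mono inter_subset_right inter_subset_right, ?_, ?_⟩
  · rw [almostClosed_iff]
    constructor
    · filter_upwards [hD, hC.1.ae_mem_L] with ω hω hreg hU
      refine mem_L_inter (hreg (U_mono inter_subset_left hU)) (hω.1 ?_)
      by_contra hG
      exact hω.2 hG (U_mono inter_subset_right hU)
    · intro h3
      obtain ⟨ω, ⟨hL, hG⟩, hω, hn⟩ := (h1.and_eventually (hD.and h3)).exists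
      exact hn (mem_L_inter hL (hω.1 hG))
  · rw [almostClosed_iff]
    constructor
    · filter_upwards [hD, hC.1.ae_mem_L] with ω hω hreg hU
      refine mem_L_inter (hreg (U_mono inter_subset_left hU)) (mem_L_compl (hω.2 fun hG => ?_))
      exact notMem_U_of_disjoint disjoint_compl_right (hω.1 hG) (U_mono inter_subset_right hU)
    · intro h3
      obtain ⟨ω, ⟨hL, hG⟩, hω, hn⟩ := (h2.and_eventually (hD.and h3)).exists
      exact hn (mem_L_inter hL (mem_L_compl (hω.2 hG)))

lemma ae_notMem_or_ae_mem_of_atomic (hirr : X.Irreducible) (hap : X.Aperiodic)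
    (hatomic : X.Atomic 1 univ) (G : Set (ℕ → S)) (hG : MeasurableSet G)
    (hinv : pathShift ⁻¹' G = G) : (∀ᵐ ω ∂X.μ, ω ∉ G) ∨ ∀ᵐ ω ∂X.μ, ω ∈ G := by
  have huniv : ∀ ω, ω ∈ X.L 1 univ := fun ω => ⟨0, fun _ _ => mem_univ _⟩
  simpa [huniv] using hatomic.ae_notMem_or_ae_mem hirr hap le_rfl G hG hinv

/-- In a simple atomic chain there are at most `m` disjoint almost closed sets for the `m`-step
chain. -/
lemma card_le_of_pairwise_disjoint (hirr : X.Irreducible) (hap : X.Aperiodic)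
    (hatomic : X.Atomic 1 univ) {m n : ℕ} (hm : 1 ≤ m) (A : Fin n → Set S)
    (hA : ∀ i, X.AlmostClosed m (A i)) (hdisj : Pairwise fun i j => Disjoint (A i) (A j)) :
    n ≤ m := by
  have hfull : ∀ i, ∀ᵐ ω ∂X.μ, ∃ r : Fin m, pathShift^[r] ω ∈ X.L m (A i) := by
    intro i
    have hmeas : MeasurableSet {ω | ∃ r : Fin m, pathShift^[r] ω ∈ X.L m (A i)} := by
      have : {ω | ∃ r : Fin m, pathShift^[r] ω ∈ X.L m (A i)}
          = ⋃ r : Fin m, pathShift^[r] ⁻¹' X.L m (A i) := by ext; simp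
      rw [this]
      exact MeasurableSet.iUnion fun r => measurable_pathShift.iterate r (X.measurableSet_L m _)
    have hmem : ∀ ω, pathShift^[m] ω ∈ X.L m (A i) ↔ ω ∈ X.L m (A i) := fun ω => by
      conv_rhs => rw [← preimage_iterate_L]
      rfl
    refine (ae_notMem_or_ae_mem_of_atomic hirr hap hatomic _ hmeas ?_).resolve_left fun h => ?_
    · ext ω
      simp only [mem_preimage, mem_ofPred_eq, ← Function.iterate_succ_apply]
      constructor
      · rintro ⟨r, h⟩
        by_cases hrm : (r : ℕ) + 1 = m
        · refine ⟨⟨0, hm⟩, ?_⟩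
          rwa [Nat.succ_eq_add_one, hrm, hmem] at h
        · exact ⟨⟨r + 1, by omega⟩, h⟩
      · rintro ⟨⟨r, hr⟩, h⟩
        rcases r with _ | r
        · refine ⟨⟨m - 1, by omega⟩, ?_⟩
          rw [Nat.succ_eq_add_one, Nat.sub_add_cancel hm, hmem]
          exact h
        · exact ⟨⟨r, by omega⟩, h⟩
    · refine (hA i).not_ae_notMem ?_
      filter_upwards [h] with ω hω hL using hω ⟨⟨0, hm⟩, hL⟩
  obtain ⟨ω, hω⟩ := (ae_all_iff.2 hfull).exists
  choose r hr using hω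
  have hinj : Function.Injective r := by
    intro i j hij
    by_contra hne
    have hj := hr j
    rw [← hij] at hj
    exact disjoint_left.1 (X.disjoint_L (hdisj hne)) (hr i) hj
  simpa using Fintype.card_le_of_injective r hinj

lemma IsBlackwell.atomic (hirr : X.Irreducible) (hap : X.Aperiodic)
    (hatomic : X.Atomic 1 univ) {m : ℕ} (hm : 1 ≤ m) {𝒞 : Set (Set S)} (h𝒞 : X.IsBlackwell m 𝒞)
    {C : Set S} (hC : C ∈ 𝒞) : X.Atomic m C := by
  by_contra hno
  obtain ⟨A, hA, hd⟩ := exists_pairwise_disjoint_of_not_atomic m (h𝒞.almostClosed C hC)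
    (h𝒞.nonatomicNoAtomicSubset C hC hno)
  have := card_le_of_pairwise_disjoint hirr hap hatomic hm A (fun i => (hA i).2) hd
  omega

lemma IsBlackwell.ae_exists_mem_L {m : ℕ} {𝒞 : Set (Set S)} (h𝒞 : X.IsBlackwell m 𝒞) :
    ∀ᵐ ω ∂X.μ, ∃ C : 𝒞, ω ∈ X.L m (C : Set S) := by
  have := h𝒞.countable.to_subtype
  have hsum := h𝒞.sum_L_eq_one
  have hdisj : Pairwise (Function.onFun Disjoint fun C : 𝒞 => X.L m (C : Set S)) :=
    fun C D hCD => X.disjoint_L (h𝒞.disjoint C.2 D.2 fun h => hCD (Subtype.ext h))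
  rw [← measure_iUnion hdisj fun C => X.measurableSet_L m _] at hsum
  have h1 := (prob_compl_eq_zero_iff (MeasurableSet.iUnion fun C : 𝒞 =>
    X.measurableSet_L m (C : Set S))).2 hsum
  filter_upwards [measure_eq_zero_iff_ae_notMem.1 h1] with ω hω
  simpa using hω

/-- A disjoint family of almost closed sets has at most as many members as a Blackwell
decomposition into atomic sets. -/
lemma IsBlackwell.encard_le {m : ℕ} {𝒞 𝒟 : Set (Set S)} (h𝒞 : X.IsBlackwell m 𝒞)
    (hatom : ∀ C ∈ 𝒞, X.Atomic m C) (h𝒟 : ∀ D ∈ 𝒟, X.AlmostClosed m D)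
    (hdisj : 𝒟.PairwiseDisjoint id) : 𝒟.encard ≤ 𝒞.encard := by
  have := h𝒞.countable.to_subtype
  have hex : ∀ D : 𝒟, ∃ C : 𝒞, ¬ ∀ᵐ ω ∂X.μ, ω ∈ X.L m (C : Set S) → ω ∉ X.L m (D : Set S) := by
    intro D
    by_contra! hno
    refine (h𝒟 D D.2).not_ae_notMem ?_
    filter_upwards [ae_all_iff.2 hno, h𝒞.ae_exists_mem_L] with ω h1 ⟨C, hC⟩ using h1 C hC
  choose φ hφ using hex
  have hinj : Function.Injective φ := by
    intro D₁ D₂ h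
    by_contra hne
    refine (hatom (φ D₁) (φ D₁).2).2 ⟨φ D₁ ∩ D₁, φ D₁ ∩ D₂, inter_subset_left, inter_subset_left,
      ?_, ?_, ?_⟩
    · exact Disjoint.mono inter_subset_right inter_subset_right
        (hdisj D₁.2 D₂.2 fun h => hne (Subtype.ext h))
    · exact (hatom _ (φ D₁).2).1.inter (h𝒟 _ D₁.2) (hφ D₁)
    · refine (hatom _ (φ D₁).2).1.inter (h𝒟 _ D₂.2) ?_
      rw [h]
      exact hφ D₂
  exact Function.Embedding.encard_le ⟨φ, hinj⟩

lemma IsBlackwell.encard_eq (hirr : X.Irreducible) (hap : X.Aperiodic)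
    (hatomic : X.Atomic 1 univ) {m : ℕ} (hm : 1 ≤ m) {𝒞 𝒟 : Set (Set S)}
    (h𝒞 : X.IsBlackwell m 𝒞) (h𝒟 : X.IsBlackwell m 𝒟) : 𝒞.encard = 𝒟.encard :=
  le_antisymm
    (h𝒟.encard_le (fun _ => h𝒟.atomic hirr hap hatomic hm) h𝒞.almostClosed h𝒞.disjoint)
    (h𝒞.encard_le (fun _ => h𝒞.atomic hirr hap hatomic hm) h𝒟.almostClosed h𝒟.disjoint)

lemma IsBlackwell.beta_eq (hirr : X.Irreducible) (hap : X.Aperiodic)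
    (hatomic : X.Atomic 1 univ) {m : ℕ} (hm : 1 ≤ m) {𝒞 : Set (Set S)}
    (h𝒞 : X.IsBlackwell m 𝒞) : X.beta m = 𝒞.encard := by
  refine le_antisymm (sInf_le ⟨𝒞, h𝒞, rfl⟩) (le_sInf ?_)
  rintro _ ⟨𝒟, h𝒟, rfl⟩
  exact (h𝒞.encard_eq hirr hap hatomic hm h𝒟).le

/-- The number `b` of sets in a Blackwell decomposition for the `m`-step chain divides `m`, and
the events attached to the decomposition are `b`-step invariant up to null events. -/
lemma IsBlackwell.card_dvd (hirr : X.Irreducible) (hap : X.Aperiodic)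
    (hatomic : X.Atomic 1 univ) {m : ℕ} (hm : 1 ≤ m) {𝒞 : Set (Set S)}
    (h𝒞 : X.IsBlackwell m 𝒞) {C : Set S} (hC : C ∈ 𝒞) :
    0 < Nat.card 𝒞 ∧ Nat.card 𝒞 ∣ m ∧
      ∀ k, ∀ᵐ ω ∂X.μ, (pathShift^[k * Nat.card 𝒞] ω ∈ X.L m C ↔ ω ∈ X.L m C) := by
  have := h𝒞.countable.to_subtype
  exact card_atoms_dvd (ι := 𝒞) measurable_pathShift hm
    (X.ae_pathShift_notMem_of_invariant hirr hap hm)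
    (ae_notMem_or_ae_mem_of_atomic hirr hap hatomic) (fun C => X.L m C)
    (fun C => X.measurableSet_L m C) (fun C => X.preimage_iterate_L m C)
    (fun C => (h𝒞.almostClosed C C.2).not_ae_notMem)
    (fun C D hCD => X.disjoint_L (h𝒞.disjoint C.2 D.2 fun h => hCD (Subtype.ext h)))
    h𝒞.ae_exists_mem_L
    (fun C => (h𝒞.atomic hirr hap hatomic hm C.2).ae_notMem_or_ae_mem hirr hap hm) ⟨C, hC⟩

lemma AlmostClosed.of_shift_invariant (hirr : X.Irreducible) (hap : X.Aperiodic) {b q : ℕ}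
    (hb : 1 ≤ b) (hq : 1 ≤ q) {C : Set S} (hC : X.AlmostClosed (q * b) C)
    (hinv : ∀ k, ∀ᵐ ω ∂X.μ, (pathShift^[k * b] ω ∈ X.L (q * b) C ↔ ω ∈ X.L (q * b) C)) :
    X.AlmostClosed b C := by
  have hm : 1 ≤ q * b := Nat.mul_pos hq hb
  have hreg : ∀ r, ∀ᵐ ω ∂X.μ,
      pathShift^[r] ω ∈ X.U (q * b) C → pathShift^[r] ω ∈ X.L (q * b) C := by
    intro r
    have := ae_iterate_notMem_of_invariant (m := q * b) measurable_pathShift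
      (X.ae_pathShift_notMem_of_invariant hirr hap hm) r
      (G := X.U (q * b) C \ X.L (q * b) C)
      ((X.measurableSet_U _ _).diff (X.measurableSet_L _ _))
      (by rw [preimage_sdiff, preimage_iterate_L, preimage_iterate_U])
      (by filter_upwards [hC.ae_mem_L] with ω hω h using h.2 (hω h.1))
    filter_upwards [this] with ω hω h1
    by_contra h2
    exact hω ⟨h1, h2⟩
  have hsub : ∀ᵐ ω ∂X.μ, ω ∈ X.L (q * b) C → ω ∈ X.L b C := by
    filter_upwards [ae_all_iff.2 hinv] with ω h1 hL
    have hall : ∀ j, ∃ N, ∀ k, N ≤ k → ω (k * (q * b) + j * b) ∈ C := fun j =>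
      (X.mem_L_iterate_iff _ _ _ _).1 ((h1 j).2 hL)
    choose N hN using hall
    refine ⟨((Finset.range q).sup N) * q, fun l hl => ?_⟩
    have h3 : N (l % q) ≤ (Finset.range q).sup N :=
      Finset.le_sup (Finset.mem_range.2 (Nat.mod_lt l hq))
    have h4 := (Nat.le_div_iff_mul_le hq).2 hl
    have := hN (l % q) (l / q) (h3.trans h4)
    rwa [← mul_assoc, ← add_mul, Nat.div_add_mod'] at this
  rw [almostClosed_iff]
  constructor
  · filter_upwards [ae_all_iff.2 hinv, ae_all_iff.2 hreg, hsub] with ω h1 h2 h3 hU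
    obtain ⟨j, hj⟩ : ∃ j, pathShift^[j * b] ω ∈ X.U (q * b) C := by
      by_contra! hno
      have hN : ∀ j, ∃ N, ∀ k, N ≤ k → ω (k * (q * b) + j * b) ∉ C := by
        intro j
        have := hno j
        rw [mem_U_iterate_iff] at this
        push Not at this
        exact this
      choose N hN using hN
      obtain ⟨l, hl, hlC⟩ := hU (((Finset.range q).sup N + 1) * q)
      refine hN (l % q) (l / q) ?_ ?_
      · have h4 : N (l % q) ≤ (Finset.range q).sup N :=
          Finset.le_sup (Finset.mem_range.2 (Nat.mod_lt l hq))
        have h5 := (Nat.le_div_iff_mul_le hq).2 hl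
        omega
      · rwa [← mul_assoc, ← add_mul, Nat.div_add_mod']
    exact h3 ((h1 j).1 (h2 _ hj))
  · intro h
    refine hC.not_ae_notMem ?_
    filter_upwards [hsub, h] with ω h1 h2 hL using h2 (h1 hL)

lemma IsBlackwell.almostClosed_card (hirr : X.Irreducible) (hap : X.Aperiodic)
    (hatomic : X.Atomic 1 univ) {m : ℕ} (hm : 1 ≤ m) {𝒞 : Set (Set S)}
    (h𝒞 : X.IsBlackwell m 𝒞) {C : Set S} (hC : C ∈ 𝒞) : X.AlmostClosed (Nat.card 𝒞) C := by
  obtain ⟨hpos, ⟨q, hq⟩, hinv⟩ := h𝒞.card_dvd hirr hap hatomic hm hC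
  rw [mul_comm] at hq
  have hAC := h𝒞.almostClosed C hC
  generalize Nat.card 𝒞 = b at *
  subst hq
  exact AlmostClosed.of_shift_invariant hirr hap hpos (Nat.pos_of_mul_pos_right hm) hAC hinv

end AlmostClosedSets

end MarkovChain

variable {S : Type} [MeasurableSpace S] [MeasurableSingletonClass S]
  [Countable S] [Infinite S]

/-- Let `X` be simple and atomic, `m ≥ 1` and `β := β(X^(m))`. Then
every set in the Blackwell decomposition for `X^(m)` is almost closed with respect
to `X^(kβ)` for all `k ≥ 1`; moreover `β(X^(β)) = β`. -/
theorem stmt5 (X : MarkovChain S) (hirr : X.Irreducible) (hap : X.Aperiodic)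
    (hsimple : X.Simple) (hatomic : X.Atomic 1 Set.univ)
    (m : ℕ) (hm : 1 ≤ m) (b : ℕ) (hb : X.beta m = (b : ℕ∞)) :
    (∀ 𝒞 : Set (Set S), X.IsBlackwell m 𝒞 → ∀ C ∈ 𝒞, ∀ k : ℕ, 1 ≤ k →
      X.AlmostClosed (k * b) C) ∧
    X.beta b = (b : ℕ∞) := by
  have hcard : ∀ 𝒞 : Set (Set S), X.IsBlackwell m 𝒞 → Nat.card 𝒞 = b := by
    intro 𝒞 h𝒞
    have h := h𝒞.beta_eq hirr hap hatomic hm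
    rw [hb] at h
    rw [Nat.card_coe_set_eq, Set.ncard, ← h, ENat.toNat_natCast]
  constructor
  · intro 𝒞 h𝒞 C hC k hk
    have h := h𝒞.almostClosed_card hirr hap hatomic hm hC
    rw [hcard 𝒞 h𝒞] at h
    exact h.mul hk
  · obtain ⟨𝒞, h𝒞⟩ : ∃ 𝒞, X.IsBlackwell m 𝒞 := by
      by_contra! hno
      simp [MarkovChain.beta, hno] at hb
    obtain ⟨ω, C, -⟩ := h𝒞.ae_exists_mem_L.exists
    obtain ⟨hpos, ⟨q, hq⟩, -⟩ := h𝒞.card_dvd hirr hap hatomic hm C.2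
    have hAC := fun C (hC : C ∈ 𝒞) => h𝒞.almostClosed_card hirr hap hatomic hm hC
    have hatom := fun C (hC : C ∈ 𝒞) => h𝒞.atomic hirr hap hatomic hm hC
    have henc := h𝒞.beta_eq hirr hap hatomic hm
    rw [hcard 𝒞 h𝒞] at hpos hq hAC
    rw [hb] at henc
    rw [mul_comm] at hq
    subst hq
    rw [henc]
    exact (h𝒞.of_mul (Nat.pos_of_mul_pos_right hm) hatom hAC).beta_eq hirr hap hatomic hpos
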